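/- There is no tile assembly system in the abstract Tile Assembly Model that finitely self-assembles the H fractal 𝐇. That is, for every aTAM tile assembly system 𝒯 = (T, σ, τ) with finite tile set T, finite τ-stable seed σ, and temperature τ, it is not the case that every finite producible assembly of 𝒯 can be extended by single-tile attachments to an assembly whose domain is exactly 𝐇. -/

import Mathlib

/-- A point of the integer lattice `ℤ²`. -/
abbrev Pt := ℤ × ℤ

/-- The generator of the H fractal. -/
def GH : Set Pt := {(0,0),(0,1),(0,2),(1,1),(2,0),(2,1),(2,2)}

/-- `scaleAdd k A B = A + k·B` (componentwise). -/
def scaleAdd (k : ℤ) (A B : Set Pt) : Set Pt :=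
  {q | ∃ p ∈ A, ∃ g ∈ B, q = (p.1 + k * g.1, p.2 + k * g.2)}

/-- The stages of the H fractal: `hstage 1 = GH` and
`hstage (i+1) = hstage i + 3^i · GH` for `i ≥ 1`. -/
def hstage : ℕ → Set Pt
  | 0 => ∅
  | 1 => GH
  | n + 2 => scaleAdd (3 ^ (n + 1)) (hstage (n + 1)) GH

/-- The H fractal `𝐇 = ⋃_{i ≥ 1} h_i`. -/
def HFractal : Set Pt := {p | ∃ i : ℕ, 1 ≤ i ∧ p ∈ hstage i}

/-- A tile type: a glue (label, drawn from `ℕ`) on each of its four sides.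
The strength of a glue label is given by a strength function. -/
structure TileType where
  north : ℕ
  east : ℕ
  south : ℕ
  west : ℕ
deriving DecidableEq

/-- An assembly: a partial function from `ℤ²` to tile types. -/
abbrev Assembly := Pt → Option TileType

/-- The domain of an assembly. -/
def adom (α : Assembly) : Set Pt := {p | α p ≠ none}

/-- The strength of the bond between the tiles of `α` at positions `p` and `q`
(zero unless `q` is adjacent to `p`, both are tiled, and the abutting glues match). -/
def bond (s : ℕ → ℕ) (α : Assembly) (p q : Pt) : ℕ :=
  match α p, α q with
  | some t, some t' =>
      if q = (p.1 + 1, p.2) then (if t.east = t'.west then s t.east else 0)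
      else if q = (p.1 - 1, p.2) then (if t.west = t'.east then s t.west else 0)
      else if q = (p.1, p.2 + 1) then (if t.north = t'.south then s t.north else 0)
      else if q = (p.1, p.2 - 1) then (if t.south = t'.north then s t.south else 0)
      else 0
  | _, _ => 0

/-- `α` is `τ`-stable: every cut of its binding graph has total glue strength at
least `τ` (witnessed by finitely many bonds crossing the cut). -/
def IsStable (s : ℕ → ℕ) (τ : ℕ) (α : Assembly) : Prop :=
  ∀ A B : Set Pt, A ∪ B = adom α → Disjoint A B → A.Nonempty → B.Nonempty →
    ∃ F : Finset (Pt × Pt), (∀ e ∈ F, e.1 ∈ A ∧ e.2 ∈ B) ∧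
      τ ≤ ∑ e ∈ F, bond s α e.1 e.2

/-- The total strength with which a tile of type `t` placed at the empty position `p`
would bind to its already-placed neighbors in `α`. -/
def attachStrength (s : ℕ → ℕ) (α : Assembly) (p : Pt) (t : TileType) : ℕ :=
  (match α (p.1 + 1, p.2) with
    | some t' => if t.east = t'.west then s t.east else 0
    | none => 0) +
  (match α (p.1 - 1, p.2) with
    | some t' => if t.west = t'.east then s t.west else 0
    | none => 0) +
  (match α (p.1, p.2 + 1) with
    | some t' => if t.north = t'.south then s t.north else 0
    | none => 0) +
  (match α (p.1, p.2 - 1) with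
    | some t' => if t.south = t'.north then s t.south else 0
    | none => 0)

/-- An aTAM tile assembly system `𝒯 = (T, σ, τ)`: a glue strength function, a finite
tile set, a finite `τ`-stable seed assembly, and a temperature `τ`. -/
structure TAS where
  strength : ℕ → ℕ
  tiles : Finset TileType
  seed : Assembly
  temp : ℕ
  seed_finite : (adom seed).Finite
  seed_tiles : ∀ p t, seed p = some t → t ∈ tiles
  seed_stable : IsStable strength temp seed

/-- A single-tile attachment step: a tile of the system attaches at an empty
position with total binding strength at least the temperature. -/
def Step (S : TAS) (α β : Assembly) : Prop :=
  ∃ p t, t ∈ S.tiles ∧ α p = none ∧ S.temp ≤ attachStrength S.strength α p t ∧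
    β = Function.update α p (some t)

/-- `β` is the result of a (finite or infinite) sequence of single-tile attachment
steps starting from `α`. -/
def ReachesFrom (S : TAS) (α β : Assembly) : Prop :=
  ∃ c : ℕ → Assembly, c 0 = α ∧ (∀ n, c (n + 1) = c n ∨ Step S (c n) (c (n + 1))) ∧
    (∀ p n t, c n p = some t → β p = some t) ∧
    (∀ p t, β p = some t → ∃ n, c n p = some t)

/-- A producible assembly: the result of a (finite or infinite) sequence of
single-tile attachment steps starting from the seed. -/
def Producible (S : TAS) (α : Assembly) : Prop := ReachesFrom S S.seed α

/-- A terminal assembly: no tile can attach to it. -/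
def Terminal (S : TAS) (α : Assembly) : Prop := ∀ β, ¬ Step S α β

/-- `S` finitely self-assembles `X` if every finite producible assembly of `S` can be
extended, by a (finite or infinite) sequence of single-tile attachment steps, to an
assembly whose domain is exactly `X`. -/
def FinitelySelfAssembles (S : TAS) (X : Set Pt) : Prop :=
  ∀ α, Producible S α → (adom α).Finite →
    ∃ β, ReachesFrom S α β ∧ adom β = X

/-- `S` strictly self-assembles `X` if every producible terminal assembly of `S`
has domain exactly `X`. -/
def StrictlySelfAssembles (S : TAS) (X : Set Pt) : Prop :=
  ∀ α, Producible S α → Terminal S α → adom α = X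

/-! ### Geometry of the H fractal in balanced coordinates -/

/-- Half-width of a stage: `(3^n - 1) / 2`. -/
def hf : ℕ → ℤ
  | 0 => 0
  | n + 1 => hf n + 3 ^ n

lemma hf_spec (n : ℕ) : 2 * hf n + 1 = 3 ^ n := by
  induction n with
  | zero => simp [hf]
  | succ n ih => simp only [hf, pow_succ]; linarith

lemma hf_nonneg (n : ℕ) : 0 ≤ hf n := by
  induction n with
  | zero => simp [hf]
  | succ n ih => simp only [hf]; positivity

lemma hf_lt_succ (n : ℕ) : hf n < hf (n + 1) := by
  simp only [hf]
  have : (0 : ℤ) < 3 ^ n := by positivity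
  linarith

lemma hf_strictMono : StrictMono hf := strictMono_nat_of_lt_succ hf_lt_succ

/-- Membership in stage `n`, in coordinates relative to the center of the stage. -/
def CC : ℕ → ℤ → ℤ → Prop
  | 0, X, Y => X = 0 ∧ Y = 0
  | n + 1, X, Y => ∃ g h : ℤ, -1 ≤ g ∧ g ≤ 1 ∧ -1 ≤ h ∧ h ≤ 1 ∧ (g = 0 → h = 0) ∧
      CC n (X - 3 ^ n * g) (Y - 3 ^ n * h)

lemma CC_neg (n : ℕ) : ∀ X Y, CC n X Y → CC n (-X) Y := by
  induction n with
  | zero => intro X Y h; simpa [CC] using h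
  | succ n ih =>
    rintro X Y ⟨g, h, h1, h2, h3, h4, h5, h6⟩
    refine ⟨-g, h, by omega, by omega, h3, h4, by omega, ?_⟩
    have := ih _ _ h6
    convert this using 1
    ring

lemma CC_bd (n : ℕ) : ∀ X Y, CC n X Y → -hf n ≤ X ∧ X ≤ hf n ∧ -hf n ≤ Y ∧ Y ≤ hf n := by
  induction n with
  | zero => rintro X Y ⟨rfl, rfl⟩; simp [hf]
  | succ n ih =>
    rintro X Y ⟨g, h, h1, h2, h3, h4, h5, h6⟩
    have := ih _ _ h6
    have h0 : (0 : ℤ) < 3 ^ n := by positivity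
    simp only [hf]
    refine ⟨?_, ?_, ?_, ?_⟩ <;> nlinarith

/-- uniqueness of the leading balanced digit -/
lemma digit_unique (n : ℕ) (X g g' : ℤ) (h1 : -hf n ≤ X - 3 ^ n * g) (h2 : X - 3 ^ n * g ≤ hf n)
    (h3 : -hf n ≤ X - 3 ^ n * g') (h4 : X - 3 ^ n * g' ≤ hf n) : g = g' := by
  have hs := hf_spec n
  have h0 : (0 : ℤ) < 3 ^ n := by positivity
  rcases lt_trichotomy g g' with h | h | h
  · have : 3 ^ n * (g' - g) ≥ 3 ^ n * 1 := by
      apply mul_le_mul_of_nonneg_left <;> linarith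
    nlinarith
  · exact h
  · have : 3 ^ n * (g - g') ≥ 3 ^ n * 1 := by
      apply mul_le_mul_of_nonneg_left <;> linarith
    nlinarith

lemma CC_succ_iff (n : ℕ) (X Y : ℤ) (g h : ℤ) (hg1 : -1 ≤ g) (hg2 : g ≤ 1)
    (hh1 : -1 ≤ h) (hh2 : h ≤ 1) (hgh : g = 0 → h = 0) (hX1 : -hf n ≤ X - 3 ^ n * g)
    (hX2 : X - 3 ^ n * g ≤ hf n) (hY1 : -hf n ≤ Y - 3 ^ n * h) (hY2 : Y - 3 ^ n * h ≤ hf n) :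
    CC (n + 1) X Y ↔ CC n (X - 3 ^ n * g) (Y - 3 ^ n * h) := by
  constructor
  · rintro ⟨g', h', _, _, _, _, _, h6⟩
    have hb := CC_bd _ _ _ h6
    have e1 := digit_unique n X g g' hX1 hX2 hb.1 hb.2.1
    have e2 := digit_unique n Y h h' hY1 hY2 hb.2.2.1 hb.2.2.2
    subst e1; subst e2; exact h6
  · intro h6
    exact ⟨g, h, hg1, hg2, hh1, hh2, hgh, h6⟩

lemma CC_narrow (k n : ℕ) (hkn : k ≤ n) : ∀ X Y, CC n X Y → -hf k ≤ X → X ≤ hf k → CC k X Y := by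
  induction n, hkn using Nat.le_induction with
  | base => intro X Y h _ _; exact h
  | succ n hkn ih =>
    rintro X Y ⟨g, h, h1, h2, h3, h4, h5, h6⟩ hx1 hx2
    have hb := CC_bd _ _ _ h6
    have hm : hf k ≤ hf n := hf_strictMono.monotone hkn
    have e : g = 0 := digit_unique n X g 0 hb.1 hb.2.1 (by linarith) (by linarith)
    have e2 := h5 e
    subst e; subst e2
    apply ih _ _ _ hx1 hx2
    simpa using h6

lemma CC_widen (k n : ℕ) (hkn : k ≤ n) : ∀ X Y, CC k X Y → CC n X Y := by
  induction n, hkn using Nat.le_induction with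
  | base => intro X Y h; exact h
  | succ n hkn ih =>
    intro X Y h
    refine ⟨0, 0, by norm_num, by norm_num, by norm_num, by norm_num, by simp, ?_⟩
    simpa using ih _ _ h

lemma CC_row (n : ℕ) : CC n (hf n) 0 := by
  induction n with
  | zero => simp [CC, hf]
  | succ n ih =>
    refine ⟨1, 0, by norm_num, by norm_num, by norm_num, by norm_num, by simp, ?_⟩
    simpa [hf] using ih

lemma CC_one (n : ℕ) (hn : 1 ≤ n) : CC n 1 0 :=
  CC_widen 1 n hn _ _ ⟨1, 0, by norm_num, by norm_num, by norm_num, by norm_num, by simp, by simp [CC]⟩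

lemma mem_GH (x y : ℤ) : (x, y) ∈ GH ↔ CC 1 (x - 1) (y - 1) := by
  constructor
  · intro h
    refine ⟨x - 1, y - 1, ?_⟩
    simp only [GH, Set.mem_insert_iff, Set.mem_singleton_iff, Prod.mk.injEq] at h
    simp only [CC, pow_zero, one_mul, sub_self, and_self, and_true]
    omega
  · rintro ⟨g, h, h1, h2, h3, h4, h5, h6, h7⟩
    simp only [GH, Set.mem_insert_iff, Set.mem_singleton_iff, Prod.mk.injEq]
    simp only [pow_zero, one_mul] at h6 h7
    omega

lemma mem_hstage (n : ℕ) : ∀ x y : ℤ,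
    (x, y) ∈ hstage (n + 1) ↔ CC (n + 1) (x - hf (n + 1)) (y - hf (n + 1)) := by
  induction n with
  | zero => intro x y; simpa [hstage, hf] using mem_GH x y
  | succ n ih =>
    intro x y
    simp only [hstage, scaleAdd, Set.mem_setOf_eq]
    constructor
    · rintro ⟨⟨p1, p2⟩, hp, ⟨g1, g2⟩, hg, he⟩
      rw [ih] at hp
      simp only [Prod.mk.injEq] at he
      rw [mem_GH] at hg
      obtain ⟨g, h, h1, h2, h3, h4, h5, h6, h7⟩ := hg
      simp only [pow_zero, one_mul] at h6 h7
      refine ⟨g, h, h1, h2, h3, h4, h5, ?_⟩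
      have eg : g = g1 - 1 := by omega
      have eh : h = g2 - 1 := by omega
      convert hp using 1
      · rw [he.1, eg, hf.eq_2 (n + 1)]; ring
      · rw [he.2, eh, hf.eq_2 (n + 1)]; ring
    · rintro ⟨g, h, h1, h2, h3, h4, h5, h6⟩
      refine ⟨(x - 3 ^ (n + 1) * (g + 1), y - 3 ^ (n + 1) * (h + 1)), ?_, (g + 1, h + 1), ?_, ?_⟩
      · rw [ih]
        convert h6 using 1
        · rw [hf.eq_2 (n + 1)]; ring
        · rw [hf.eq_2 (n + 1)]; ring
      · rw [mem_GH]
        exact ⟨g, h, h1, h2, h3, h4, h5, by simp [CC]⟩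
      · simp

lemma CC_shift (n k : ℕ) (hnk : n ≤ k) (x y : ℤ) (hx0 : 0 ≤ x) (hx1 : x ≤ 2 * hf n)
    (hy0 : 0 ≤ y) (hy1 : y ≤ 2 * hf n) :
    CC k (x - hf k) (y - hf k) ↔ CC n (x - hf n) (y - hf n) := by
  induction k, hnk using Nat.le_induction with
  | base => rfl
  | succ k hnk ih =>
    rw [← ih]
    have hm : hf n ≤ hf k := hf_strictMono.monotone hnk
    have e : ∀ z : ℤ, z - hf k = z - hf (k + 1) - 3 ^ k * (-1) := by
      intro z; simp only [hf]; ring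
    rw [e x, e y]
    apply CC_succ_iff <;> first | norm_num | skip
    all_goals simp only [hf]; linarith

lemma mem_HFractal_iff (n : ℕ) (hn : 1 ≤ n) (X Y : ℤ) (hX0 : -hf n ≤ X) (hX1 : X ≤ hf n)
    (hY0 : -hf n ≤ Y) (hY1 : Y ≤ hf n) :
    ((hf n + X, hf n + Y) : Pt) ∈ HFractal ↔ CC n X Y := by
  have key : ∀ i, 1 ≤ i → ∀ x y : ℤ, (x, y) ∈ hstage i ↔ CC i (x - hf i) (y - hf i) := by
    intro i hi x y
    obtain ⟨i, rfl⟩ := Nat.exists_eq_add_of_le' hi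
    exact mem_hstage i x y
  have e : CC n X Y ↔ CC n (hf n + X - hf n) (hf n + Y - hf n) := by
    simp
  rw [e]
  constructor
  · rintro ⟨i, hi, h⟩
    rw [key i hi] at h
    rcases le_total n i with hni | hni
    · exact (CC_shift n i hni _ _ (by linarith) (by linarith) (by linarith) (by linarith)).1 h
    · have hb := CC_bd _ _ _ h
      exact (CC_shift i n hni _ _ (by linarith) (by linarith) (by linarith) (by linarith)).2 h
  · intro h
    exact ⟨n, hn, (key n hn _ _).2 h⟩

lemma HFractal_nonneg (p : Pt) (hp : p ∈ HFractal) : 0 ≤ p.1 ∧ 0 ≤ p.2 := by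
  obtain ⟨i, hi, h⟩ := hp
  obtain ⟨i, rfl⟩ := Nat.exists_eq_add_of_le' hi
  have := CC_bd _ _ _ ((mem_hstage i p.1 p.2).1 h)
  constructor <;> linarith

/-- Position at offset `(X, Y)` (mirrored if `ε = -1`) from the center of stage `m + 2`. -/
def PP (ε : ℤ) (m : ℕ) (X Y : ℤ) : Pt := (hf (m + 2) + ε * X, hf (m + 2) + Y)

lemma mem_PP (ε : ℤ) (hε : ε = 1 ∨ ε = -1) (m : ℕ) (X Y : ℤ) (hX0 : -hf (m + 2) ≤ X)
    (hX1 : X ≤ hf (m + 2)) (hY0 : -hf (m + 2) ≤ Y) (hY1 : Y ≤ hf (m + 2)) :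
    PP ε m X Y ∈ HFractal ↔ CC (m + 2) X Y := by
  rcases hε with rfl | rfl
  · simpa [PP] using mem_HFractal_iff (m + 2) (by omega) X Y hX0 hX1 hY0 hY1
  · have := mem_HFractal_iff (m + 2) (by omega) (-X) Y (by linarith) (by linarith) hY0 hY1
    simp only [PP, neg_mul, one_mul]
    rw [this]
    constructor
    · intro h; simpa using CC_neg _ _ _ h
    · exact CC_neg _ _ _

/-- Adjacency of lattice points. -/
def AdjR (X Y X' Y' : ℤ) : Prop :=
  (X' = X ∧ (Y' = Y + 1 ∨ Y' = Y - 1)) ∨ (Y' = Y ∧ (X' = X + 1 ∨ X' = X - 1))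

/-- The region between the gates `d₋₁, d₀, d₁` and the central gate. -/
def MM (m : ℕ) (X Y : ℤ) : Prop := CC (m + 1) X Y ∧ -3 ^ m < X ∧ X < 0

/-- The zones confining the growth from each gate. -/
def ZZ (a m : ℕ) (v X Y : ℤ) : Prop :=
  (v ≠ 0 ∧ CC a (X + 3 ^ m) (Y - 3 ^ m * v) ∧ 0 < X + 3 ^ m) ∨
  (v = 0 ∧ ((CC m (X + 3 ^ m) Y ∧ 0 < X + 3 ^ m) ∨ (CC m X Y ∧ X < 0)))

lemma MM_box (m : ℕ) (X Y : ℤ) (h : MM m X Y) :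
    -hf (m + 1) ≤ Y ∧ Y ≤ hf (m + 1) := by
  have := CC_bd _ _ _ h.1
  exact this.2.2

lemma G1 (m : ℕ) (X Y X' Y' : ℤ) (h : MM m X Y) (hadj : AdjR X Y X' Y')
    (hC : CC (m + 2) X' Y') : MM m X' Y' ∨ (X' = 0 ∧ Y' = 0 ∧ X = -1 ∧ Y = 0) ∨
      ∃ v : ℤ, -1 ≤ v ∧ v ≤ 1 ∧ X' = -3 ^ m ∧ Y' = 3 ^ m * v ∧ X = -3 ^ m + 1 ∧ Y = 3 ^ m * v := by
  obtain ⟨h1, h2, h3⟩ := h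
  have hs := hf_spec m
  have hn := hf_nonneg m
  have hx : -3 ^ m ≤ X' ∧ X' ≤ 0 := by
    rcases hadj with ⟨_, _⟩ | ⟨_, _ | _⟩ <;> constructor <;> linarith
  have hC1 : CC (m + 1) X' Y' := by
    apply CC_narrow _ _ (by omega) _ _ hC <;> simp only [hf] <;> linarith
  rcases eq_or_lt_of_le hx.2 with h0 | h0
  · right; left
    have := CC_narrow 0 _ (by omega) _ _ hC1 (by simp [hf, h0]) (by simp [hf, h0])
    obtain ⟨_, h5⟩ := this
    rcases hadj with ⟨_, _⟩ | ⟨_, _ | _⟩ <;> refine ⟨h0, h5, ?_, ?_⟩ <;> linarith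
  rcases eq_or_lt_of_le hx.1 with h6 | h6
  · right; right
    obtain ⟨g, v, g1, g2, v1, v2, _, h7⟩ := hC1
    have hb := CC_bd _ _ _ h7
    have : g = -1 := digit_unique m X' _ _ hb.1 hb.2.1 (by linarith) (by linarith)
    subst this
    have h8 := CC_narrow 0 _ (by omega) _ _ h7 (by simp only [hf]; linarith) (by simp only [hf]; linarith)
    obtain ⟨_, h9⟩ := h8
    have h10 : Y' = 3 ^ m * v := by linarith
    refine ⟨v, v1, v2, h6.symm, h10, ?_⟩
    rcases hadj with ⟨_, _⟩ | ⟨_, _ | _⟩ <;> constructor <;> linarith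
  · left; exact ⟨hC1, h6, h0⟩

lemma ZZ_band (a m : ℕ) (v X Y : ℤ) (h : ZZ a m v X Y) :
    (v ≠ 0 ∧ -hf a ≤ Y - 3 ^ m * v ∧ Y - 3 ^ m * v ≤ hf a) ∨
    (v = 0 ∧ -hf m ≤ Y ∧ Y ≤ hf m) := by
  rcases h with ⟨h1, h2, _⟩ | ⟨h1, ⟨h2, _⟩ | ⟨h2, _⟩⟩
  all_goals have := CC_bd _ _ _ h2; tauto

lemma hf_gap (a m : ℕ) (h : a < m) (ha : 1 ≤ a) : hf a + 3 ≤ hf m := by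
  have : hf (a + 1) ≤ hf m := hf_strictMono.monotone h
  simp only [hf] at this
  have h3 : (3 : ℤ) ^ 1 ≤ 3 ^ a := pow_le_pow_right₀ (by norm_num) ha
  linarith

lemma G3 (a m : ℕ) (ham : a < m) (ha : 1 ≤ a) (v v' X Y X' Y' : ℤ)
    (hv1 : -1 ≤ v) (hv2 : v ≤ 1) (hv1' : -1 ≤ v') (hv2' : v' ≤ 1)
    (h : ZZ a m v X Y) (h' : ZZ a m v' X' Y') (h1 : Y - Y' ≤ 2) (h2 : Y' - Y ≤ 2) : v = v' := by
  have hg := hf_gap a m ham ha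
  have hs := hf_spec m
  have hn := hf_nonneg a
  have b := ZZ_band _ _ _ _ _ h
  have b' := ZZ_band _ _ _ _ _ h'
  obtain rfl | rfl | rfl : v = -1 ∨ v = 0 ∨ v = 1 := by omega
  all_goals obtain rfl | rfl | rfl : v' = -1 ∨ v' = 0 ∨ v' = 1 := by omega
  all_goals first | rfl | (exfalso; simp at b b'; linarith)

lemma G4 (a m : ℕ) (ham : a < m) (ha : 1 ≤ a) (v : ℤ) :
    ZZ a m v (-3 ^ m + 1) (3 ^ m * v) := by
  by_cases hv : v = 0
  · right; refine ⟨hv, Or.inl ⟨?_, by simp⟩⟩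
    simpa [hv] using CC_one m (by omega)
  · left; refine ⟨hv, ?_, by simp⟩
    simpa using CC_one a ha

lemma G4c (a m : ℕ) (ham : a < m) : ZZ a m 0 (-1) 0 := by
  right; exact ⟨rfl, Or.inr ⟨CC_neg _ _ _ (CC_one m (by omega)), by norm_num⟩⟩

lemma G5 (a m t : ℕ) (ham : a < m) (ha : 1 ≤ a) (v X Y X' Y' : ℤ) (hv1 : -1 ≤ v) (hv2 : v ≤ 1)
    (ht : (v ≠ 0 ∧ t = a) ∨ (v = 0 ∧ m < t))
    (hM : MM m X Y) (hZ : ¬ ZZ a m v X Y) (hadj : AdjR X Y X' Y') (hZ' : ZZ a m v X' Y') :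
    (-hf (t + 2) ≤ X + 3 ^ m - 3 ^ t ∧ X + 3 ^ m - 3 ^ t ≤ hf (t + 2) ∧
      -hf (t + 2) ≤ Y - 3 ^ m * v + 3 ^ t * v ∧ Y - 3 ^ m * v + 3 ^ t * v ≤ hf (t + 2)) ∧
    ¬ CC (t + 2) (X + 3 ^ m - 3 ^ t) (Y - 3 ^ m * v + 3 ^ t * v) := by
  obtain ⟨hC, hX1, hX2⟩ := hM
  have hg := hf_gap a m ham ha
  have hs := hf_spec m
  have hst := hf_spec t
  have hn := hf_nonneg a
  have hnt := hf_nonneg t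
  rcases ht with ⟨hv, rfl⟩ | ⟨rfl, hmt⟩
  · obtain ⟨_, hc', hp'⟩ : v ≠ 0 ∧ CC t (X' + 3 ^ m) (Y' - 3 ^ m * v) ∧ 0 < X' + 3 ^ m := by
      rcases hZ' with h | h
      · exact h
      · exact absurd h.1 hv
    have hb' := CC_bd _ _ _ hc'
    have hYv : -hf m ≤ Y - 3 ^ m * v ∧ Y - 3 ^ m * v ≤ hf m := by
      rcases hadj with ⟨_, _ | _⟩ | ⟨_, _ | _⟩ <;> constructor <;> linarith
    have hU : hf t < X + 3 ^ m := by
      by_contra hU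
      apply hZ
      left
      refine ⟨hv, ?_, by linarith⟩
      obtain ⟨g, w, g1, g2, w1, w2, _, h7⟩ := hC
      have hb := CC_bd _ _ _ h7
      have e1 : g = -1 := digit_unique m X _ _ hb.1 hb.2.1 (by linarith) (by linarith)
      have e2 : w = v := digit_unique m Y _ _ hb.2.2.1 hb.2.2.2 (by linarith) (by linarith)
      subst e1; subst e2
      apply CC_narrow _ _ ham.le _ _ _ (by linarith) (by linarith)
      convert h7 using 1; ring
    have hXe : X + 3 ^ m = hf t + 1 ∧ Y = Y' := by
      rcases hadj with ⟨_, _ | _⟩ | ⟨_, _ | _⟩ <;> constructor <;> linarith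
    have hx : X + 3 ^ m - 3 ^ t = - hf t := by linarith
    rw [hx]
    have h3 : hf (t + 2) = hf t + 3 ^ t + 3 ^ t * 3 := by simp only [hf, pow_succ]
    refine ⟨?_, ?_⟩
    · obtain rfl | rfl : v = -1 ∨ v = 1 := by omega
      all_goals refine ⟨?_, ?_, ?_, ?_⟩ <;> linarith
    · intro hcc
      have := CC_bd _ _ _ (CC_narrow t _ (by omega) _ _ hcc (by linarith) (by linarith))
      obtain rfl | rfl : v = -1 ∨ v = 1 := by omega
      all_goals linarith [this.2.2.1, this.2.2.2]
  · have hb' := ZZ_band _ _ _ _ _ hZ'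
    simp at hb'
    obtain ⟨g, w, g1, g2, w1, w2, hgw, h7⟩ := hC
    have hb := CC_bd _ _ _ h7
    have hg0 : g ≠ 0 := by
      intro hg0
      have := hgw hg0
      subst hg0; subst this
      exact hZ (Or.inr ⟨rfl, Or.inr ⟨by simpa using h7, hX2⟩⟩)
    have hg1 : g = -1 := by
      by_contra hne
      have : g = 1 := by omega
      subst this
      linarith
    subst hg1
    have hw0 : w ≠ 0 := by
      intro hw0
      subst hw0
      refine hZ (Or.inr ⟨rfl, Or.inl ⟨?_, by linarith⟩⟩)
      convert h7 using 1 <;> ring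
    have hY : (hf m < Y ∨ Y < -hf m) ∧ -hf m - 1 ≤ Y ∧ Y ≤ hf m + 1 := by
      refine ⟨?_, ?_⟩
      · obtain rfl | rfl : w = -1 ∨ w = 1 := by omega
        · right; linarith
        · left; linarith
      · rcases hadj with ⟨_, _ | _⟩ | ⟨_, _ | _⟩ <;> constructor <;> linarith
    have hgt := hf_gap m t hmt (by omega)
    have h3 : hf (t + 2) = hf t + 3 ^ t + 3 ^ t * 3 := by simp only [hf, pow_succ]
    have h4 : hf (t + 1) = hf t + 3 ^ t := by simp only [hf]
    refine ⟨⟨by linarith, by linarith, by linarith, by linarith⟩, ?_⟩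
    intro hcc
    have c1 := CC_narrow (t + 1) _ (by omega) _ _ hcc (by linarith) (by linarith)
    have c2 := (CC_succ_iff t _ _ (-1) 0 (by norm_num) (by norm_num) (by norm_num) (by norm_num)
      (by simp) (by linarith) (by linarith) (by linarith) (by linarith)).1 c1
    have c3 := CC_bd _ _ _ (CC_narrow m _ (by omega) _ _ c2 (by linarith) (by linarith))
    rcases hY.1 with h | h <;> linarith [c3.2.2.1, c3.2.2.2]

lemma G6 (a m t b : ℕ) (ham : a < m) (hbt : b < t) (v v' X Y : ℤ)
    (hv1 : -1 ≤ v) (hv2 : v ≤ 1) (hv1' : -1 ≤ v') (hv2' : v' ≤ 1)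
    (ht : (v ≠ 0 ∧ t = a) ∨ (v = 0 ∧ m < t)) (hZ : ZZ a m v X Y)
    (hZ' : ZZ b t v' (X + 3 ^ m - 3 ^ t) (Y - 3 ^ m * v + 3 ^ t * v)) : v' = v := by
  have b1 := ZZ_band _ _ _ _ _ hZ
  have b2 := ZZ_band _ _ _ _ _ hZ'
  have hst := hf_spec t
  have hlt := hf_strictMono hbt
  have hnb := hf_nonneg b
  rcases ht with ⟨hv, rfl⟩ | ⟨rfl, hmt⟩
  · obtain rfl | rfl : v = -1 ∨ v = 1 := by omega
    all_goals obtain rfl | rfl | rfl : v' = -1 ∨ v' = 0 ∨ v' = 1 := by omega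
    all_goals first | rfl | (exfalso; simp at b1 b2; linarith)
  · have hlt2 := hf_strictMono hmt
    obtain rfl | rfl | rfl : v' = -1 ∨ v' = 0 ∨ v' = 1 := by omega
    all_goals first | rfl | (exfalso; simp at b1 b2; linarith)

lemma G7 (a m t : ℕ) (v X Y : ℤ)
    (hv1 : -1 ≤ v) (hv2 : v ≤ 1)
    (ht : (v ≠ 0 ∧ t = a) ∨ (v = 0 ∧ m < t)) (hZ : ZZ a m v X Y) :
    MM t (X + 3 ^ m - 3 ^ t) (Y - 3 ^ m * v + 3 ^ t * v) := by
  have main : ∀ U V : ℤ, CC t U V → 0 < U → MM t (U - 3 ^ t) (V + 3 ^ t * v) := by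
    intro U V h hU
    have hb := CC_bd _ _ _ h
    have hs := hf_spec t
    have hn := hf_nonneg t
    refine ⟨⟨-1, v, by norm_num, by norm_num, hv1, hv2, by simp, ?_⟩, by linarith, by linarith⟩
    convert h using 1 <;> ring
  rcases ht with ⟨hv, rfl⟩ | ⟨rfl, hmt⟩
  · rcases hZ with ⟨_, h1, h2⟩ | h
    · exact main _ _ h1 h2
    · exact absurd h.1 hv
  · rcases hZ with h | ⟨_, ⟨h1, h2⟩ | ⟨h1, h2⟩⟩
    · exact absurd rfl h.1
    · have := main _ _ (CC_widen m t hmt.le _ _ h1) h2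
      simpa using this
    · have hb := CC_bd _ _ _ h1
      have hs := hf_spec m
      have hn := hf_nonneg m
      have h3 : CC (m + 1) (X + 3 ^ m) Y :=
        ⟨1, 0, by norm_num, by norm_num, by norm_num, by norm_num, by simp, by simpa using h1⟩
      have := main _ _ (CC_widen (m + 1) t hmt _ _ h3) (by linarith)
      simpa using this

lemma G8 (a m : ℕ) (ham : a < m) (ha : 1 ≤ a) :
    MM m (-3 ^ m + hf m) (-3 ^ m) ∧
      ∀ v : ℤ, -1 ≤ v → v ≤ 1 → ¬ ZZ a m v (-3 ^ m + hf m) (-3 ^ m) := by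
  have hs := hf_spec m
  have hg := hf_gap a m ham ha
  have hn := hf_nonneg a
  refine ⟨⟨⟨-1, -1, by norm_num, by norm_num, by norm_num, by norm_num, by simp, ?_⟩,
    by linarith, by linarith⟩, ?_⟩
  · convert CC_row m using 1 <;> ring
  · intro v h1 h2 hZ
    have hb := ZZ_band _ _ _ _ _ hZ
    obtain rfl | rfl | rfl : v = -1 ∨ v = 0 ∨ v = 1 := by omega
    · rcases hZ with ⟨_, h3, _⟩ | h
      · have := CC_bd _ _ _ h3
        linarith [this.2.1]
      · exact absurd h.1 (by norm_num)
    · simp at hb; linarith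
    · simp at hb; linarith

/-! ### Dynamics -/

/-- Adjacency of points, as a relation on `Pt`. -/
def AdjP (p q : Pt) : Prop := AdjR p.1 p.2 q.1 q.2

/-- Finite reachability by attachment steps from the seed. -/
def FReach (S : TAS) (α : Assembly) : Prop := Relation.ReflTransGen (Step S) S.seed α

lemma FReach.chain {S : TAS} {α : Assembly} (h : FReach S α) :
    ∃ c : ℕ → Assembly, c 0 = S.seed ∧ (∀ n, c (n + 1) = c n ∨ Step S (c n) (c (n + 1))) ∧
      ∃ N, ∀ k, N ≤ k → c k = α := by
  induction h with
  | refl => exact ⟨fun _ => S.seed, rfl, fun _ => Or.inl rfl, 0, fun _ _ => rfl⟩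
  | @tail α β _ hs ih =>
    obtain ⟨c, h0, h1, N, hN⟩ := ih
    refine ⟨fun k => if k ≤ N then c k else β, by simp [h0], ?_, N + 1, ?_⟩
    · intro n
      by_cases hn : n + 1 ≤ N
      · have hn' : n ≤ N := by omega
        simp only [hn, hn', if_true]
        exact h1 n
      · by_cases hn' : n ≤ N
        · have : n = N := by omega
          subst this
          right
          simp [hN n le_rfl, hs]
        · left; simp [hn, hn']
    · intro k hk
      have : ¬ k ≤ N := by omega
      simp [this]

lemma chain_mono {S : TAS} {c : ℕ → Assembly}
    (h1 : ∀ n, c (n + 1) = c n ∨ Step S (c n) (c (n + 1))) {n k : ℕ} (hnk : n ≤ k)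
    {p : Pt} {t : TileType} (h : c n p = some t) : c k p = some t := by
  induction k, hnk using Nat.le_induction with
  | base => exact h
  | succ k _ ih =>
    rcases h1 k with h2 | ⟨q, t', _, hq, _, h2⟩
    · rw [h2]; exact ih
    · rw [h2, Function.update_apply]
      split_ifs with hpq
      · subst hpq; rw [hq] at ih; cases ih
      · exact ih

lemma FReach.producible {S : TAS} {α : Assembly} (h : FReach S α) : Producible S α := by
  obtain ⟨c, h0, h1, N, hN⟩ := h.chain
  refine ⟨c, h0, h1, ?_, ?_⟩
  · intro p n t hp
    rw [← hN (max n N) (le_max_right _ _)]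
    exact chain_mono h1 (le_max_left _ _) hp
  · intro p t hp
    exact ⟨N, by rw [hN N le_rfl]; exact hp⟩

lemma FReach.finite {S : TAS} {α : Assembly} (h : FReach S α) : (adom α).Finite := by
  induction h with
  | refl => exact S.seed_finite
  | @tail α β _ hs ih =>
    obtain ⟨p, t, _, _, _, rfl⟩ := hs
    apply (ih.insert p).subset
    intro q hq
    by_cases hqp : q = p
    · exact Or.inl hqp
    · right
      simpa [adom, Function.update_apply, hqp] using hq

lemma FReach.subset {S : TAS} {X : Set Pt} (hS : FinitelySelfAssembles S X) {α : Assembly}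
    (h : FReach S α) : adom α ⊆ X := by
  obtain ⟨β, ⟨c, h0, _, h2, _⟩, hX⟩ := hS α h.producible h.finite
  intro p hp
  rw [← hX]
  obtain ⟨t, ht⟩ := Option.ne_none_iff_exists'.1 hp
  have := h2 p 0 t (by rw [h0]; exact ht)
  simp [adom, this]

/-- An assembly sequence from the seed with result of domain `X`. -/
structure Run (S : TAS) (X : Set Pt) where
  c : ℕ → Assembly
  β : Assembly
  c0 : c 0 = S.seed
  step : ∀ n, c (n + 1) = c n ∨ Step S (c n) (c (n + 1))
  le : ∀ p n t, c n p = some t → β p = some t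
  ex : ∀ p t, β p = some t → ∃ n, c n p = some t
  dom : adom β = X

namespace Run

variable {S : TAS} {X : Set Pt} (R : Run S X)

/-- The first time at which `p` is tiled. -/
noncomputable def tm (p : Pt) : ℕ := sInf {n | R.c n p ≠ none}

lemma freach (n : ℕ) : FReach S (R.c n) := by
  induction n with
  | zero => rw [R.c0]; exact Relation.ReflTransGen.refl
  | succ n ih =>
    rcases R.step n with h | h
    · rw [h]; exact ih
    · exact Relation.ReflTransGen.tail ih h

lemma exists_of_mem {p : Pt} (hp : p ∈ X) : ∃ n, R.c n p ≠ none := by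
  rw [← R.dom] at hp
  obtain ⟨t, ht⟩ := Option.ne_none_iff_exists'.1 hp
  obtain ⟨n, hn⟩ := R.ex p t ht
  exact ⟨n, by simp [hn]⟩

lemma eq_beta {p : Pt} {n : ℕ} (h : R.c n p ≠ none) : R.c n p = R.β p := by
  obtain ⟨t, ht⟩ := Option.ne_none_iff_exists'.1 h
  rw [ht, R.le p n t ht]

lemma mem_of_ne {p : Pt} {n : ℕ} (h : R.c n p ≠ none) : p ∈ X := by
  rw [← R.dom]
  have := R.eq_beta h
  rw [this] at h
  exact h

lemma tm_le {p : Pt} {n : ℕ} (h : R.c n p ≠ none) : R.tm p ≤ n := Nat.sInf_le h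

lemma ne_none {p : Pt} {n : ℕ} (hp : p ∈ X) (h : R.tm p ≤ n) : R.c n p ≠ none := by
  have h1 : R.c (R.tm p) p ≠ none := Nat.sInf_mem (R.exists_of_mem hp)
  obtain ⟨t, ht⟩ := Option.ne_none_iff_exists'.1 h1
  rw [chain_mono R.step h ht]
  simp

lemma tm_lt_of_none {p : Pt} {n : ℕ} (hp : p ∈ X) (h : R.c n p = none) : n < R.tm p := by
  by_contra h1
  exact R.ne_none hp (by omega) h

lemma none_of_lt {p : Pt} {n : ℕ} (h : n < R.tm p) : R.c n p = none := by
  by_contra h1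
  have := R.tm_le h1
  omega

lemma tm_pos {p : Pt} (hp : p ∈ X) (h : S.seed p = none) : 0 < R.tm p := by
  apply R.tm_lt_of_none hp
  rw [R.c0]; exact h

/-- The attachment step placing `p`. -/
lemma attach {p : Pt} (hp : p ∈ X) {n : ℕ} (hn : R.tm p = n + 1) :
    ∃ t ∈ S.tiles, R.c n p = none ∧ S.temp ≤ attachStrength S.strength (R.c n) p t ∧
      R.c (n + 1) = Function.update (R.c n) p (some t) := by
  have h1 : R.c n p = none := R.none_of_lt (by omega)
  have h2 : R.c (n + 1) p ≠ none := R.ne_none hp hn.le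
  rcases R.step n with h | ⟨q, t, ht, hq, hs, h⟩
  · rw [h] at h2; exact absurd h1 h2
  · by_cases hqp : p = q
    · subst hqp; exact ⟨t, ht, hq, hs, h⟩
    · rw [h, Function.update_of_ne hqp] at h2; exact absurd h1 h2

lemma tm_inj {p q : Pt} (hp : p ∈ X) (hq : q ∈ X) (h0 : 0 < R.tm p) (h : R.tm p = R.tm q) :
    p = q := by
  obtain ⟨n, hn⟩ := Nat.exists_eq_add_of_lt h0
  rw [zero_add] at hn
  obtain ⟨t, _, _, _, h3⟩ := R.attach hp hn
  by_contra hne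
  have h4 : R.c (n + 1) q ≠ none := R.ne_none hq (by omega)
  rw [h3, Function.update_of_ne (Ne.symm hne)] at h4
  have := R.tm_le h4
  omega

lemma beta_tiles {p : Pt} {t : TileType} (h : R.β p = some t) : t ∈ S.tiles := by
  have hp : p ∈ X := by rw [← R.dom]; simp [adom, h]
  rcases Nat.eq_zero_or_pos (R.tm p) with h0 | h0
  · have := R.ne_none hp h0.le
    have h1 := R.eq_beta this
    rw [R.c0] at h1
    exact S.seed_tiles p t (h1.trans h)
  · obtain ⟨n, hn⟩ := Nat.exists_eq_add_of_lt h0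
    rw [zero_add] at hn
    obtain ⟨t', ht', _, _, h3⟩ := R.attach hp hn
    have h4 : R.c (n + 1) p = some t' := by rw [h3]; simp
    have := R.le _ _ _ h4
    rw [h] at this
    cases this
    exact ht'

lemma support (hτ : 0 < S.temp) {p : Pt} (hp : p ∈ X) (h0 : 0 < R.tm p) :
    ∃ r ∈ X, AdjP p r ∧ R.tm r < R.tm p := by
  obtain ⟨n, hn⟩ := Nat.exists_eq_add_of_lt h0
  rw [zero_add] at hn
  obtain ⟨t, _, _, h2, _⟩ := R.attach hp hn
  by_contra hcon
  push Not at hcon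
  have key : ∀ r, AdjP p r → R.c n r = none := by
    intro r hr
    by_contra h
    have := hcon r (R.mem_of_ne h) hr
    have := R.tm_le h
    omega
  have e1 := key (p.1 + 1, p.2) (by simp [AdjP, AdjR])
  have e2 := key (p.1 - 1, p.2) (by simp [AdjP, AdjR])
  have e3 := key (p.1, p.2 + 1) (by simp [AdjP, AdjR])
  have e4 := key (p.1, p.2 - 1) (by simp [AdjP, AdjR])
  simp only [attachStrength, e1, e2, e3, e4] at h2
  omega

end Run

lemma attach_mono (s : ℕ → ℕ) (α α' : Assembly) (p δ : Pt) (t : TileType)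
    (h : ∀ r, AdjP p r → ∀ t', α r = some t' → α' (r.1 + δ.1, r.2 + δ.2) = some t') :
    attachStrength s α p t ≤ attachStrength s α' (p.1 + δ.1, p.2 + δ.2) t := by
  have e1 := h (p.1 + 1, p.2) (by simp [AdjP, AdjR])
  have e2 := h (p.1 - 1, p.2) (by simp [AdjP, AdjR])
  have e3 := h (p.1, p.2 + 1) (by simp [AdjP, AdjR])
  have e4 := h (p.1, p.2 - 1) (by simp [AdjP, AdjR])
  simp only at e1 e2 e3 e4
  have a1 : p.1 + δ.1 + 1 = p.1 + 1 + δ.1 := by ring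
  have a2 : p.1 + δ.1 - 1 = p.1 - 1 + δ.1 := by ring
  have a3 : p.2 + δ.2 + 1 = p.2 + 1 + δ.2 := by ring
  have a4 : p.2 + δ.2 - 1 = p.2 - 1 + δ.2 := by ring
  simp only [attachStrength, a1, a2, a3, a4]
  refine add_le_add (add_le_add (add_le_add ?_ ?_) ?_) ?_
  · cases h1 : α (p.1 + 1, p.2) with
    | none => simp
    | some t' => rw [e1 t' h1]
  · cases h1 : α (p.1 - 1, p.2) with
    | none => simp
    | some t' => rw [e2 t' h1]
  · cases h1 : α (p.1, p.2 + 1) with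
    | none => simp
    | some t' => rw [e3 t' h1]
  · cases h1 : α (p.1, p.2 - 1) with
    | none => simp
    | some t' => rw [e4 t' h1]

open Classical in
/-- Replaying the growth of `W` (which is supported only by `W` and `d`) at a translated place. -/
lemma Run.replay {S : TAS} {X : Set Pt} (hS : FinitelySelfAssembles S X) (R : Run S X)
    (W : Set Pt) (d δ : Pt) (n0 : ℕ) (hWX : W ⊆ X) (hdW : d ∉ W) (hW0 : ∀ w ∈ W, 0 < R.tm w)
    (hsup : ∀ w ∈ W, ∀ r ∈ X, AdjP w r → R.tm r < R.tm w → r ∈ W ∨ r = d)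
    (hd : R.c n0 (d.1 + δ.1, d.2 + δ.2) = R.β d)
    (hemp : ∀ w ∈ W, R.c n0 (w.1 + δ.1, w.2 + δ.2) = none) (w : Pt) (hw : w ∈ W) :
    ((w.1 + δ.1, w.2 + δ.2) : Pt) ∈ X := by
  set A : ℕ → Assembly := fun n q =>
    if ((q.1 - δ.1, q.2 - δ.2) : Pt) ∈ W ∧ R.c n (q.1 - δ.1, q.2 - δ.2) ≠ none
    then R.c n (q.1 - δ.1, q.2 - δ.2) else R.c n0 q with hA
  have hAW : ∀ n r, r ∈ W → R.c n r ≠ none → A n (r.1 + δ.1, r.2 + δ.2) = R.c n r := by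
    intro n r hr h
    simp [hA, hr, h]
  have hAd : ∀ n, A n (d.1 + δ.1, d.2 + δ.2) = R.β d := by
    intro n
    simp [hA, hdW, hd]
  have hreach : ∀ n, FReach S (A n) := by
    intro n
    induction n with
    | zero =>
      have : A 0 = R.c n0 := by
        funext q
        simp only [hA]
        rw [if_neg]
        rintro ⟨h1, h2⟩
        have := hW0 _ h1
        have := R.tm_le h2
        omega
      rw [this]
      exact R.freach n0
    | succ n ih =>
      rcases R.step n with h | ⟨p, t, ht, hp, hs, h⟩
      · have : A (n + 1) = A n := by simp only [hA, h]
        rw [this]; exact ih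
      · have hpn : R.c (n + 1) p ≠ none := by rw [h]; simp
        have hpX := R.mem_of_ne hpn
        have htm : R.tm p = n + 1 := by
          have h1 := R.tm_le hpn
          have h2 := R.tm_lt_of_none hpX hp
          omega
        by_cases hpW : p ∈ W
        · refine Relation.ReflTransGen.tail ih ⟨(p.1 + δ.1, p.2 + δ.2), t, ht, ?_, ?_, ?_⟩
          · simp [hA, hp, hemp p hpW]
          · refine hs.trans (attach_mono _ _ _ _ _ _ ?_)
            intro r hr t' hrt
            have hrn : R.c n r ≠ none := by simp [hrt]
            have h3 := R.tm_le hrn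
            rcases hsup p hpW r (R.mem_of_ne hrn) hr (by omega) with h4 | h4
            · rw [hAW n r h4 hrn, hrt]
            · subst h4
              rw [hAd n, ← R.eq_beta hrn, hrt]
          · funext q
            by_cases hq : q = (p.1 + δ.1, p.2 + δ.2)
            · subst hq
              rw [hAW (n + 1) p hpW hpn, h]
              simp
            · rw [Function.update_of_ne hq]
              have hne : ((q.1 - δ.1, q.2 - δ.2) : Pt) ≠ p := by
                intro he
                apply hq
                rw [← he]
                simp
              simp only [hA, h, Function.update_of_ne hne]
        · have : A (n + 1) = A n := by
            funext q
            by_cases hqW : ((q.1 - δ.1, q.2 - δ.2) : Pt) ∈ W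
            · have hne : ((q.1 - δ.1, q.2 - δ.2) : Pt) ≠ p := by
                intro he
                rw [he] at hqW
                exact hpW hqW
              simp only [hA, h, Function.update_of_ne hne]
            · simp [hA, hqW]
          rw [this]; exact ih
  have h1 := R.ne_none (hWX hw) le_rfl
  apply (hreach (R.tm w)).subset hS
  simp only [adom]
  show A (R.tm w) (w.1 + δ.1, w.2 + δ.2) ≠ none
  rw [hAW _ w hw h1]
  exact h1

/-! ### Confinement -/

/-- The gates on the far side of the region `MM`. -/
def DD (ε : ℤ) (m : ℕ) (v : ℤ) : Pt := PP ε m (-3 ^ m) (3 ^ m * v)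

lemma PP_inj {ε : ℤ} (hε : ε = 1 ∨ ε = -1) {m : ℕ} {X Y X' Y' : ℤ}
    (h : PP ε m X Y = PP ε m X' Y') : X = X' ∧ Y = Y' := by
  simp only [PP, Prod.mk.injEq] at h
  rcases hε with rfl | rfl <;> constructor <;> linarith

lemma MM_mem {ε : ℤ} (hε : ε = 1 ∨ ε = -1) {m : ℕ} {X Y : ℤ} (h : MM m X Y) :
    PP ε m X Y ∈ HFractal := by
  have hb := CC_bd _ _ _ h.1
  have hl := hf_lt_succ (m + 1)
  have e : m + 1 + 1 = m + 2 := rfl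
  rw [e] at hl
  rw [mem_PP ε hε] <;> try linarith
  exact CC_widen _ _ (by omega) _ _ h.1

lemma DD_mem {ε : ℤ} (hε : ε = 1 ∨ ε = -1) {m : ℕ} {v : ℤ} (h1 : -1 ≤ v) (h2 : v ≤ 1) :
    DD ε m v ∈ HFractal := by
  have hc : CC (m + 1) (-3 ^ m) (3 ^ m * v) := by
    refine ⟨-1, v, by norm_num, by norm_num, h1, h2, by simp, ?_⟩
    have : CC m 0 0 := CC_widen 0 m (by omega) _ _ ⟨rfl, rfl⟩
    convert this using 1 <;> ring
  have hb := CC_bd _ _ _ hc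
  have hl := hf_lt_succ (m + 1)
  have e : m + 1 + 1 = m + 2 := rfl
  rw [e] at hl
  rw [DD, mem_PP ε hε] <;> try linarith
  exact CC_widen _ _ (by omega) _ _ hc

lemma PP_adj {ε : ℤ} (hε : ε = 1 ∨ ε = -1) {m : ℕ} {X Y : ℤ} {r : Pt}
    (h : AdjP (PP ε m X Y) r) : ∃ X' Y', r = PP ε m X' Y' ∧ AdjR X Y X' Y' := by
  obtain ⟨r1, r2⟩ := r
  refine ⟨ε * (r1 - hf (m + 2)), r2 - hf (m + 2), ?_, ?_⟩
  · rcases hε with rfl | rfl <;> simp [PP]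
  · simp only [AdjP, AdjR, PP] at h ⊢
    rcases hε with rfl | rfl <;> omega

lemma MM_nbr {ε : ℤ} (hε : ε = 1 ∨ ε = -1) {m : ℕ} {X Y : ℤ} {r : Pt} (hM : MM m X Y)
    (hr : r ∈ HFractal) (h : AdjP (PP ε m X Y) r) :
    ∃ X' Y', r = PP ε m X' Y' ∧ AdjR X Y X' Y' ∧ CC (m + 2) X' Y' := by
  obtain ⟨X', Y', rfl, hadj⟩ := PP_adj hε h
  refine ⟨X', Y', rfl, hadj, ?_⟩
  have hb := CC_bd _ _ _ hM.1
  have hl := hf_lt_succ (m + 1)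
  have e : m + 1 + 1 = m + 2 := rfl
  rw [e] at hl
  rw [mem_PP ε hε] at hr
  · exact hr
  all_goals simp only [AdjR] at hadj; omega

section
variable {S : TAS} (R : Run S HFractal) {ε : ℤ} (hε : ε = 1 ∨ ε = -1)

lemma nbZ (hε : ε = 1 ∨ ε = -1) {a m : ℕ} (ham : a < m) (ha : 1 ≤ a)
    (hB : R.tm (PP ε m (-1) 0) < R.tm (PP ε m 0 0)) (t0 : ℕ)
    (hz : ∀ X Y, MM m X Y → R.tm (PP ε m X Y) < t0 → ∃ v, -1 ≤ v ∧ v ≤ 1 ∧ ZZ a m v X Y)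
    {v X Y : ℤ} (hv1 : -1 ≤ v) (hv2 : v ≤ 1) (hM : MM m X Y) (hZ : ZZ a m v X Y)
    (ht : R.tm (PP ε m X Y) ≤ t0) {r : Pt} (hr : r ∈ HFractal) (hadj : AdjP (PP ε m X Y) r)
    (hlt : R.tm r < R.tm (PP ε m X Y)) :
    (∃ X' Y', r = PP ε m X' Y' ∧ MM m X' Y' ∧ ZZ a m v X' Y') ∨ r = DD ε m v := by
  obtain ⟨X', Y', rfl, hadj', hC⟩ := MM_nbr hε hM hr hadj
  rcases G1 m X Y X' Y' hM hadj' hC with h | ⟨rfl, rfl, rfl, rfl⟩ | ⟨w, hw1, hw2, rfl, rfl, rfl, rfl⟩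
  · left
    obtain ⟨w, hw1, hw2, hw⟩ := hz X' Y' h (by omega)
    have : v = w := by
      refine G3 a m ham ha v w X Y X' Y' hv1 hv2 hw1 hw2 hZ hw ?_ ?_ <;>
        simp only [AdjR] at hadj' <;> omega
    subst this
    exact ⟨X', Y', rfl, h, hw⟩
  · omega
  · right
    have : v = w := G3 a m ham ha v w _ _ _ _ hv1 hv2 hw1 hw2 hZ (G4 a m ham ha w)
      (by linarith) (by linarith)
    subst this
    rfl

lemma occ (hτ : 0 < S.temp) (hε : ε = 1 ∨ ε = -1) {a m : ℕ} (ham : a < m) (ha : 1 ≤ a)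
    (hpos : ∀ X Y, MM m X Y → 0 < R.tm (PP ε m X Y))
    (hB : R.tm (PP ε m (-1) 0) < R.tm (PP ε m 0 0)) (t0 : ℕ)
    (hz : ∀ X Y, MM m X Y → R.tm (PP ε m X Y) < t0 → ∃ v, -1 ≤ v ∧ v ≤ 1 ∧ ZZ a m v X Y)
    {v : ℤ} (hv1 : -1 ≤ v) (hv2 : v ≤ 1) : ∀ n X Y, MM m X Y → ZZ a m v X Y →
    R.tm (PP ε m X Y) = n → n ≤ t0 → R.tm (DD ε m v) < n := by
  intro n
  induction n using Nat.strong_induction_on with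
  | _ n ih =>
    intro X Y hM hZ hn hnt
    obtain ⟨r, hr, hadj, hlt⟩ := R.support hτ (MM_mem hε hM) (hpos X Y hM)
    rcases nbZ R hε ham ha hB t0 hz hv1 hv2 hM hZ (by omega) hr hadj hlt with
      ⟨X', Y', rfl, hM', hZ'⟩ | rfl
    · have := ih _ (by omega) X' Y' hM' hZ' rfl (by omega)
      omega
    · omega

/-- The number of gates placed before time `t`. -/
noncomputable def cnt (ε : ℤ) (m : ℕ) (t : ℕ) : ℕ :=
  (({-1, 0, 1} : Finset ℤ).filter (fun l => R.tm (DD ε m l) < t)).card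

lemma cnt_mono (m : ℕ) {t t' : ℕ} (h : t ≤ t') : cnt R ε m t ≤ cnt R ε m t' := by
  apply Finset.card_le_card
  intro l hl
  simp only [Finset.mem_filter] at hl ⊢
  exact ⟨hl.1, by omega⟩

lemma cnt_lt (m : ℕ) {v : ℤ} (hv1 : -1 ≤ v) (hv2 : v ≤ 1) {t : ℕ} (h : R.tm (DD ε m v) < t) :
    cnt R ε m (R.tm (DD ε m v)) < cnt R ε m t := by
  apply Finset.card_lt_card
  rw [Finset.ssubset_iff_of_subset]
  · refine ⟨v, ?_, ?_⟩
    · simp only [Finset.mem_filter, Finset.mem_insert, Finset.mem_singleton]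
      exact ⟨by omega, h⟩
    · simp
  · intro l hl
    simp only [Finset.mem_filter] at hl ⊢
    exact ⟨hl.1, by omega⟩

lemma confine (hS : FinitelySelfAssembles S HFractal) (hτ : 0 < S.temp) (hε : ε = 1 ∨ ε = -1)
    (a : ℕ → ℕ) (ha : StrictMono a) (ha1 : ∀ j, 1 ≤ a j)
    (hpos : ∀ j X Y, MM (a j) X Y → 0 < R.tm (PP ε (a j) X Y))
    (hB : ∀ j, R.tm (PP ε (a j) (-1) 0) < R.tm (PP ε (a j) 0 0))
    (htype : ∀ j j' v, -1 ≤ v → v ≤ 1 → R.β (DD ε (a j) v) = R.β (DD ε (a j') v))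
    (hrank : ∀ j j' v, -1 ≤ v → v ≤ 1 →
      cnt R ε (a j) (R.tm (DD ε (a j) v)) = cnt R ε (a j') (R.tm (DD ε (a j') v))) :
    ∀ N j, N ≤ j → ∀ n X Y, MM (a (j + 1)) X Y → R.tm (PP ε (a (j + 1)) X Y) = n →
      cnt R ε (a (j + 1)) n ≤ N → ∃ v, -1 ≤ v ∧ v ≤ 1 ∧ ZZ (a j) (a (j + 1)) v X Y := by
  intro N
  induction N with
  | zero => ?_
  | succ N ihN => ?_
  all_goals
    intro j hj n
    induction n using Nat.strong_induction_on with
    | _ n ih => ?_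
    intro X Y hM hn hcnt
    by_contra hcon
    push Not at hcon
    have ham : a j < a (j + 1) := ha (by omega)
    have hz : ∀ X' Y', MM (a (j + 1)) X' Y' → R.tm (PP ε (a (j + 1)) X' Y') < n →
        ∃ v, -1 ≤ v ∧ v ≤ 1 ∧ ZZ (a j) (a (j + 1)) v X' Y' := fun X' Y' hM' hlt =>
      ih _ hlt X' Y' hM' rfl ((cnt_mono R _ hlt.le).trans hcnt)
    -- all earlier neighbours of `p` lie in the region
    have hnb : ∀ r ∈ HFractal, AdjP (PP ε (a (j + 1)) X Y) r → R.tm r < n →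
        ∃ X' Y' v, r = PP ε (a (j + 1)) X' Y' ∧ AdjR X Y X' Y' ∧ MM (a (j + 1)) X' Y' ∧
          -1 ≤ v ∧ v ≤ 1 ∧ ZZ (a j) (a (j + 1)) v X' Y' := by
      intro r hr hadj hlt
      obtain ⟨X', Y', rfl, hadj', hC⟩ := MM_nbr hε hM hr hadj
      rcases G1 _ X Y X' Y' hM hadj' hC with
        h | ⟨rfl, rfl, rfl, rfl⟩ | ⟨w, hw1, hw2, rfl, rfl, rfl, rfl⟩
      · obtain ⟨v, hv1, hv2, hv⟩ := hz X' Y' h hlt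
        exact ⟨X', Y', v, rfl, hadj', h, hv1, hv2, hv⟩
      · exact absurd (G4c _ _ ham) (hcon 0 (by norm_num) (by norm_num))
      · exact absurd (G4 _ _ ham (ha1 j) w) (hcon w hw1 hw2)
    obtain ⟨r, hr, hadj, hlt⟩ := R.support hτ (MM_mem hε hM) (hpos _ X Y hM)
    obtain ⟨X1, Y1, v, rfl, hadj1, hM1, hv1, hv2, hZ1⟩ := hnb r hr hadj (by omega)
    have hocc := occ R hτ hε ham (ha1 j) (hpos _) (hB _) n hz hv1 hv2 _ X1 Y1 hM1 hZ1 rfl (by omega)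
    have hD : R.tm (DD ε (a (j + 1)) v) < n := by omega
    have hrk := cnt_lt R (a (j + 1)) hv1 hv2 hD
  · omega
  · -- the target scale
    obtain ⟨i, hi, htgt⟩ : ∃ i, N ≤ i ∧ ((v ≠ 0 ∧ a (i + 1) = a j) ∨ (v = 0 ∧ a (j + 1) < a (i + 1))) := by
      by_cases hv : v = 0
      · exact ⟨j + 1, by omega, Or.inr ⟨hv, ha (by omega)⟩⟩
      · exact ⟨j - 1, by omega, Or.inl ⟨hv, by congr 1; omega⟩⟩
    have hai : a i < a (i + 1) := ha (by omega)
    set m := a (j + 1) with hm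
    set t := a (i + 1) with ht
    have hz' : ∀ X' Y', MM t X' Y' → R.tm (PP ε t X' Y') < R.tm (DD ε t v) →
        ∃ v, -1 ≤ v ∧ v ≤ 1 ∧ ZZ (a i) t v X' Y' := by
      intro X' Y' hM' hlt'
      apply ihN i hi _ X' Y' hM' rfl
      have h1 := cnt_mono R (ε := ε) t hlt'.le
      have h2 := hrank (i + 1) (j + 1) v hv1 hv2
      rw [← hm, ← ht] at h2
      rw [← ht]
      omega
    have hesc := G5 (a j) m t ham (ha1 j) v X Y X1 Y1 hv1 hv2 htgt hM (hcon v hv1 hv2) hadj1 hZ1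
    -- translation
    set δ : Pt := (hf (t + 2) - hf (m + 2) + ε * (3 ^ m - 3 ^ t),
      hf (t + 2) - hf (m + 2) - 3 ^ m * v + 3 ^ t * v) with hδ
    have htr : ∀ X' Y', (((PP ε m X' Y').1 + δ.1, (PP ε m X' Y').2 + δ.2) : Pt) =
        PP ε t (X' + 3 ^ m - 3 ^ t) (Y' - 3 ^ m * v + 3 ^ t * v) := by
      intro X' Y'
      simp only [PP, hδ, Prod.mk.injEq]
      constructor <;> ring
    have hnotin : (((PP ε m X Y).1 + δ.1, (PP ε m X Y).2 + δ.2) : Pt) ∉ HFractal := by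
      rw [htr, mem_PP ε hε _ _ _ hesc.1.1 hesc.1.2.1 hesc.1.2.2.1 hesc.1.2.2.2]
      exact hesc.2
    apply hnotin
    refine R.replay hS {w | ∃ X' Y', w = PP ε m X' Y' ∧ MM m X' Y' ∧ R.tm w ≤ n ∧
      ((X' = X ∧ Y' = Y) ∨ (R.tm w < n ∧ ZZ (a j) m v X' Y'))} (DD ε m v) δ (R.tm (DD ε t v))
      ?_ ?_ ?_ ?_ ?_ ?_ _ ⟨X, Y, rfl, hM, hn.le, Or.inl ⟨rfl, rfl⟩⟩
    · rintro w ⟨X', Y', rfl, hM', _⟩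
      exact MM_mem hε hM'
    · rintro ⟨X', Y', he, hM', _⟩
      have := (PP_inj hε he).1
      have := hM'.2.1
      omega
    · rintro w ⟨X', Y', rfl, hM', _⟩
      exact hpos _ _ _ hM'
    · rintro w ⟨X', Y', rfl, hM', hwn, ⟨rfl, rfl⟩ | ⟨hwn', hZ'⟩⟩ r hr hadjr hltr
      · left
        obtain ⟨X2, Y2, v2, rfl, hadj2, hM2, hv21, hv22, hZ2⟩ := hnb r hr hadjr (by omega)
        have : v = v2 := by
          refine G3 (a j) m ham (ha1 j) v v2 X1 Y1 X2 Y2 hv1 hv2 hv21 hv22 hZ1 hZ2 ?_ ?_ <;>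
            simp only [AdjR] at hadj1 hadj2 <;> omega
        subst this
        exact ⟨X2, Y2, rfl, hM2, by omega, Or.inr ⟨by omega, hZ2⟩⟩
      · rcases nbZ R hε ham (ha1 j) (hB _) n hz hv1 hv2 hM' hZ' hwn hr hadjr hltr with
          ⟨X2, Y2, rfl, hM2, hZ2⟩ | h
        · left
          exact ⟨X2, Y2, rfl, hM2, by omega, Or.inr ⟨by omega, hZ2⟩⟩
        · right; exact h
    · have e : (((DD ε m v).1 + δ.1, (DD ε m v).2 + δ.2) : Pt) = DD ε t v := by
        rw [DD, htr, DD]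
        congr 1 <;> ring
      rw [e, R.eq_beta (R.ne_none (DD_mem hε hv1 hv2) le_rfl)]
      exact htype _ _ v hv1 hv2
    · rintro w ⟨X', Y', rfl, hM', hwn, ⟨rfl, rfl⟩ | ⟨hwn', hZ'⟩⟩
      · by_contra hne
        exact hnotin (R.mem_of_ne hne)
      · rw [htr]
        by_contra hne
        have hMt := G7 (a j) m t v X' Y' hv1 hv2 htgt hZ'
        have hle := R.tm_le hne
        have hlt' : R.tm (PP ε t (X' + 3 ^ m - 3 ^ t) (Y' - 3 ^ m * v + 3 ^ t * v)) <
            R.tm (DD ε t v) := by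
          refine lt_of_le_of_ne hle ?_
          intro he
          have := R.tm_inj (MM_mem hε hMt) (DD_mem hε hv1 hv2) (hpos _ _ _ hMt) he
          have := (PP_inj hε this).1
          have := hMt.2.1
          omega
        obtain ⟨w, hw1, hw2, hw⟩ := hz' _ _ hMt hlt'
        have hwv := G6 (a j) m t (a i) ham hai v w X' Y' hv1 hv2 hw1 hw2 htgt hZ' hw
        subst hwv
        have := occ R hτ hε hai (ha1 i) (hpos _) (hB _) _ hz' hv1 hv2 _ _ _ hMt hw rfl hlt'.le
        omega

end

/-- The contradiction at positive temperature. -/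
lemma main_pos {S : TAS} (hS : FinitelySelfAssembles S HFractal) (hτ : 0 < S.temp)
    (R : Run S HFractal) : False := by
  classical
  -- scales beyond the seed
  obtain ⟨m1, hm1⟩ : ∃ m1 : ℕ, ∀ p : Pt, S.seed p ≠ none → p.2 < m1 := by
    obtain ⟨b, hb⟩ := (S.seed_finite.image Prod.snd).bddAbove
    refine ⟨(b + 1).toNat, fun p hp => ?_⟩
    have := hb ⟨p, hp, rfl⟩
    omega
  have hseed : ∀ (ε : ℤ) (m : ℕ) (X Y : ℤ), m1 ≤ m → -hf (m + 1) ≤ Y →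
      S.seed (PP ε m X Y) = none := by
    intro ε m X Y hm hY
    by_contra hne
    have h1 := hm1 _ hne
    simp only [PP] at h1
    have h2 : hf (m + 2) = hf (m + 1) + 3 ^ (m + 1) := rfl
    have h3 : ((m + 1 : ℕ) : ℤ) < 3 ^ (m + 1) := by
      exact_mod_cast Nat.lt_pow_self (by norm_num : 1 < 3)
    have h4 : (m1 : ℤ) ≤ m := by exact_mod_cast hm
    push_cast at h3
    linarith
  -- orientation of the central gate
  have hor : ∀ m, m1 ≤ m → ∃ ε : ℤ, (ε = 1 ∨ ε = -1) ∧
      R.tm (PP ε m (-1) 0) < R.tm (PP ε m 0 0) := by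
    intro m hm
    have hn2 := hf_nonneg (m + 2)
    have hc : PP 1 m 0 0 ∈ HFractal := by
      rw [mem_PP 1 (Or.inl rfl)] <;> try linarith
      exact CC_widen 0 _ (by omega) _ _ ⟨rfl, rfl⟩
    have h0 : 0 < R.tm (PP 1 m 0 0) := by
      apply R.tm_pos hc
      apply hseed _ _ _ _ hm
      have := hf_nonneg (m + 1)
      linarith
    obtain ⟨r, hr, hadj, hlt⟩ := R.support hτ hc h0
    obtain ⟨X', Y', rfl, hadj'⟩ := PP_adj (Or.inl rfl) hadj
    have hge : 1 ≤ hf (m + 2) := by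
      have := hf_strictMono (show 0 < m + 2 by omega)
      simp only [hf] at this ⊢
      omega
    rw [mem_PP 1 (Or.inl rfl)] at hr
    rotate_left
    iterate 4 (simp only [AdjR] at hadj'; omega)
    rcases hadj' with ⟨rfl, h⟩ | ⟨rfl, h⟩
    · have := CC_narrow 0 _ (by omega) _ _ hr (by simp [hf]) (by simp [hf])
      have := this.2
      omega
    · rcases h with rfl | rfl
      · refine ⟨-1, Or.inr rfl, ?_⟩
        simpa [PP] using hlt
      · refine ⟨1, Or.inl rfl, ?_⟩
        simpa [PP] using hlt
  choose! e he1 he2 using hor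
  -- colours
  have htile : ∀ m, m1 ≤ m → ∀ v : ℤ, -1 ≤ v → v ≤ 1 →
      R.β (DD (e m) m v) ∈ (S.tiles.image some : Finset (Option TileType)) := by
    intro m hm v h1 h2
    have hD : DD (e m) m v ∈ HFractal := DD_mem (he1 m hm) h1 h2
    rw [← R.dom] at hD
    obtain ⟨t, ht⟩ := Option.ne_none_iff_exists'.1 hD
    rw [ht]
    exact Finset.mem_image_of_mem _ (R.beta_tiles ht)
  let Lset : Finset ℤ := {-1, 0, 1}
  let Col := ({1, -1} : Finset ℤ) × (Lset → (S.tiles.image some : Finset (Option TileType))) ×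
    (Lset → Fin 4)
  have hL : ∀ v : Lset, -1 ≤ v.1 ∧ v.1 ≤ 1 := by
    rintro ⟨v, hv⟩
    simp only [Lset, Finset.mem_insert, Finset.mem_singleton] at hv
    constructor <;> simp only <;> omega
  have hcnt : ∀ ε m t, cnt R ε m t < 4 := by
    intro ε m t
    have : cnt R ε m t ≤ ({-1, 0, 1} : Finset ℤ).card := Finset.card_filter_le _ _
    have h3 : ({-1, 0, 1} : Finset ℤ).card = 3 := by decide
    omega
  let col : ℕ → Col := fun k =>
    (⟨e (m1 + 1 + k), by
        rcases he1 (m1 + 1 + k) (by omega) with h | h <;> simp [h]⟩,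
      fun v => ⟨R.β (DD (e (m1 + 1 + k)) (m1 + 1 + k) v.1),
        htile _ (by omega) _ (hL v).1 (hL v).2⟩,
      fun v => ⟨cnt R (e (m1 + 1 + k)) (m1 + 1 + k)
        (R.tm (DD (e (m1 + 1 + k)) (m1 + 1 + k) v.1)), hcnt _ _ _⟩)
  obtain ⟨y, hy⟩ := Finite.exists_infinite_fiber col
  have hinf : (col ⁻¹' {y}).Infinite := Set.infinite_coe_iff.1 hy
  obtain ⟨φ, hφ, hφy⟩ : ∃ φ : ℕ → ℕ, StrictMono φ ∧ ∀ n, col (φ n) = y :=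
    ⟨_, Nat.nth_strictMono hinf, fun n => Nat.nth_mem_of_infinite hinf n⟩
  have hcol : ∀ j j', col (φ j) = col (φ j') := fun j j' => (hφy j).trans (hφy j').symm
  set a : ℕ → ℕ := fun j => m1 + 1 + φ j with ha
  have hea : ∀ j, e (a j) = e (a 0) := by
    intro j
    have := congrArg (fun x : Col => (x.1 : ℤ)) (hcol j 0)
    exact this
  set ε := e (a 0) with hεdef
  have hε : ε = 1 ∨ ε = -1 := he1 _ (by simp only [ha]; omega)
  have hamono : StrictMono a := fun x y h => by
    have := hφ h
    simp only [ha]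
    omega
  have hpos : ∀ j X Y, MM (a j) X Y → 0 < R.tm (PP ε (a j) X Y) := by
    intro j X Y hM
    apply R.tm_pos (MM_mem hε hM)
    exact hseed _ _ _ _ (by simp only [ha]; omega) (MM_box _ _ _ hM).1
  have hconf := confine R hS hτ hε a hamono (fun j => by simp only [ha]; omega) hpos
    (fun j => by
      have := he2 (a j) (by simp only [ha]; omega)
      rw [hea j] at this
      exact this)
    (fun j j' v h1 h2 => by
      have hv : v ∈ Lset := by
        simp only [Lset, Finset.mem_insert, Finset.mem_singleton]; omega
      have := congrArg (fun x : Col => ((x.2.1 ⟨v, hv⟩ : _) : Option TileType)) (hcol j j')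
      have h3 : R.β (DD (e (a j)) (a j) v) = R.β (DD (e (a j')) (a j') v) := this
      rwa [hea j, hea j'] at h3)
    (fun j j' v h1 h2 => by
      have hv : v ∈ Lset := by
        simp only [Lset, Finset.mem_insert, Finset.mem_singleton]; omega
      have := congrArg (fun x : Col => ((x.2.2 ⟨v, hv⟩ : Fin 4) : ℕ)) (hcol j j')
      have h3 : cnt R (e (a j)) (a j) (R.tm (DD (e (a j)) (a j) v)) =
        cnt R (e (a j')) (a j') (R.tm (DD (e (a j')) (a j') v)) := this
      rwa [hea j, hea j'] at h3)
  have h8 := G8 (a 3) (a 4) (hamono (by omega)) (by simp only [ha]; omega)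
  obtain ⟨v, hv1, hv2, hZ⟩ := hconf 3 3 le_rfl _ _ _ h8.1 rfl (by
    have := hcnt ε (a (3 + 1)) (R.tm (PP ε (a (3 + 1)) (-3 ^ (a 4) + hf (a 4)) (-3 ^ (a 4))))
    omega)
  exact h8.2 v hv1 hv2 hZ

/-- No aTAM tile assembly system finitely self-assembles the
H fractal `𝐇`. -/
theorem hFractal_not_finitelySelfAssembles :
    ∀ S : TAS, ¬ FinitelySelfAssembles S HFractal := by
  intro S hS
  have h0 : FReach S S.seed := Relation.ReflTransGen.refl
  obtain ⟨β, ⟨c, c0, c1, c2, c3⟩, hdom⟩ := hS S.seed h0.producible S.seed_finite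
  let R : Run S HFractal := ⟨c, β, c0, c1, c2, c3, hdom⟩
  rcases Nat.eq_zero_or_pos S.temp with hτ | hτ
  · -- temperature zero: a tile may attach anywhere
    have hz : ((0, 0) : Pt) ∈ HFractal := ⟨1, le_rfl, by simp [hstage, GH]⟩
    rw [← hdom] at hz
    obtain ⟨t, ht⟩ := Option.ne_none_iff_exists'.1 hz
    have htile : t ∈ S.tiles := R.beta_tiles ht
    have hneg : ((-1, -1) : Pt) ∉ HFractal := by
      intro h
      have := (HFractal_nonneg _ h).1
      norm_num at this
    have hnone : S.seed (-1, -1) = none := by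
      by_contra h
      exact hneg (h0.subset hS h)
    have h1 : FReach S (Function.update S.seed (-1, -1) (some t)) :=
      Relation.ReflTransGen.tail h0 ⟨(-1, -1), t, htile, hnone, by omega, rfl⟩
    apply hneg
    apply h1.subset hS
    simp [adom]
  · exact main_pos hS hτ R
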